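/- arXiv:1103.5478 — 2 statements merged into one kernel-verified Lean document; each statement's English description precedes it below -/
import Mathlib

section
/- For every x > 0, any minimizer q* of q ↦ P{⟨q,X⟩ ≤ x} over Θ(t) takes at most two distinct nonzero values: there exist k, l ≥ 0 with k + l ≤ t and p_1, p_2 ∈ [0,1] with k·p_1 + l·p_2 = 1 such that, up to a permutation of coordinates, q* = (p_1,…,p_1, p_2,…,p_2, 0,…,0) with p_1 appearing k times and p_2 appearing l times. -/
open MeasureTheory ProbabilityTheory Finset

/-- The law of `(X_1, …, X_t)` where the `X_i` are i.i.d. `Exp(1)`. -/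
noncomputable def expLaw (t : ℕ) : Measure (Fin t → ℝ) :=
  Measure.pi fun _ => expMeasure 1

/-- The outage probability `P{⟨q,X⟩ ≤ x}`. -/
noncomputable def outage (t : ℕ) (x : ℝ) (q : Fin t → ℝ) : ℝ :=
  ((expLaw t) {v | ∑ i, q i * v i ≤ x}).toReal

/-- The simplex `Θ(t) = {q ∈ ℝ₊^t : ∑ q_i = 1}`. -/
def simplexEq (t : ℕ) : Set (Fin t → ℝ) :=
  {q | (∀ i, 0 ≤ q i) ∧ ∑ i, q i = 1}

/-- `expConv a f x = ∫₀ˣ a⁻¹ e^{-(x-y)/a} f(y) dy`: convolution of `f` with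
the density of `a · Exp(1)`. -/
noncomputable def expConv (a : ℝ) (f : ℝ → ℝ) (x : ℝ) : ℝ :=
  a⁻¹ * (Real.exp (-x / a) * ∫ y in (0:ℝ)..x, Real.exp (y / a) * f y)

lemma expConv_zero (a : ℝ) (f : ℝ → ℝ) : expConv a f 0 = 0 := by
  simp [expConv]

lemma hasDerivAt_expConv {a : ℝ} (ha : 0 < a) {f : ℝ → ℝ} (hf : Continuous f) (x : ℝ) :
    HasDerivAt (expConv a f) ((f x - expConv a f x) / a) x := by
  have hc : Continuous fun y => Real.exp (y / a) * f y := by fun_prop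
  have h1 := hc.integral_hasStrictDerivAt 0 x |>.hasDerivAt
  have h2 : HasDerivAt (fun x : ℝ => Real.exp (-x / a)) (Real.exp (-x / a) * (-1 / a)) x :=
    ((hasDerivAt_id x).neg.div_const a).exp
  refine ((h2.mul h1).const_mul a⁻¹).congr_deriv ?_
  have h3 : Real.exp (-x / a) * Real.exp (x / a) = 1 := by
    rw [← Real.exp_add]; simp [neg_div]
  simp only [expConv]
  generalize Real.exp (-x / a) = e at *
  generalize Real.exp (x / a) = e' at *
  field_simp
  linear_combination a * f x * h3

lemma continuous_expConv {a : ℝ} (ha : 0 < a) {f : ℝ → ℝ} (hf : Continuous f) :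
    Continuous (expConv a f) :=
  continuous_iff_continuousAt.2 fun x => (hasDerivAt_expConv ha hf x).continuousAt

lemma eq_expConv {a : ℝ} (ha : 0 < a) {f g : ℝ → ℝ} (hf : Continuous f) (h0 : g 0 = 0)
    (hg : ∀ x, HasDerivAt g ((f x - g x) / a) x) : g = expConv a f := by
  have hd : ∀ x, HasDerivAt (fun x => Real.exp (x / a) * (g x - expConv a f x)) 0 x := by
    intro x
    have h2 : HasDerivAt (fun x : ℝ => Real.exp (x / a)) (Real.exp (x / a) * (1 / a)) x :=
      ((hasDerivAt_id x).div_const a).exp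
    refine (h2.mul ((hg x).sub (hasDerivAt_expConv ha hf x))).congr_deriv ?_
    simp only [Pi.sub_apply]
    field_simp
    ring
  funext x
  have h := is_const_of_deriv_eq_zero (fun x => (hd x).differentiableAt)
    (fun x => (hd x).deriv) x 0
  simp only [h0, expConv_zero, sub_self, mul_zero, mul_eq_zero, Real.exp_ne_zero, false_or] at h
  linarith

lemma expConv_sub {a : ℝ} (ha : 0 < a) {f g : ℝ → ℝ} (hf : Continuous f) (hg : Continuous g) :
    expConv a (fun y => f y - g y) = fun y => expConv a f y - expConv a g y := by
  refine (eq_expConv ha (by fun_prop) (by simp [expConv_zero]) fun x => ?_).symm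
  refine ((hasDerivAt_expConv ha hf x).sub (hasDerivAt_expConv ha hg x)).congr_deriv ?_
  ring

lemma expConv_div_const {a : ℝ} (ha : 0 < a) {f : ℝ → ℝ} (hf : Continuous f) (c : ℝ) :
    expConv a (fun y => f y / c) = fun y => expConv a f y / c := by
  refine (eq_expConv ha (by fun_prop) (by simp [expConv_zero]) fun x => ?_).symm
  refine ((hasDerivAt_expConv ha hf x).div_const c).congr_deriv ?_
  ring

/-- The resolvent identity. -/
lemma expConv_expConv {a b : ℝ} (ha : 0 < a) (hb : 0 < b) (hab : a ≠ b) {f : ℝ → ℝ}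
    (hf : Continuous f) (x : ℝ) :
    expConv a (expConv b f) x = (a * expConv a f x - b * expConv b f x) / (a - b) := by
  have hab' : a - b ≠ 0 := sub_ne_zero.2 hab
  refine congrFun (eq_expConv ha (g := fun x => (a * expConv a f x - b * expConv b f x) / (a - b))
    (continuous_expConv hb hf) (by simp [expConv_zero]) fun x => ?_).symm x
  refine ((((hasDerivAt_expConv ha hf x).const_mul a).sub
    ((hasDerivAt_expConv hb hf x).const_mul b)).div_const (a - b)).congr_deriv ?_
  field_simp
  ring

lemma expConv_comm {a b : ℝ} (ha : 0 < a) (hb : 0 < b) {f : ℝ → ℝ} (hf : Continuous f) :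
    expConv a (expConv b f) = expConv b (expConv a f) := by
  rcases eq_or_ne a b with rfl | hab
  · rfl
  funext x
  rw [expConv_expConv ha hb hab hf, expConv_expConv hb ha hab.symm hf, ← neg_sub a b, div_neg,
    ← neg_div]
  ring

/-- Convolution commutes with differentiation for functions vanishing at the origin. -/
lemma hasDerivAt_expConv_of_zero {a : ℝ} (ha : 0 < a) {f f' : ℝ → ℝ} (h0 : f 0 = 0)
    (hf : ∀ x, HasDerivAt f (f' x) x) (hf' : Continuous f') (x : ℝ) :
    HasDerivAt (expConv a f) (expConv a f' x) x := by
  have hc : Continuous f := continuous_iff_continuousAt.2 fun x => (hf x).continuousAt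
  have h : (fun x => (f x - expConv a f x) / a) = expConv a f' := by
    refine eq_expConv ha hf' (by simp [h0, expConv_zero]) fun x => ?_
    refine (((hf x).sub (hasDerivAt_expConv ha hc x)).div_const a).congr_deriv ?_
    ring
  rw [← h]
  exact hasDerivAt_expConv ha hc x

lemma hasDerivAt_expConv_expConv {a b : ℝ} (ha : 0 < a) (hb : 0 < b) (hab : a ≠ b) {f : ℝ → ℝ}
    (hf : Continuous f) (x : ℝ) :
    HasDerivAt (expConv a (expConv b f)) ((expConv b f x - expConv a f x) / (a - b)) x := by
  refine (hasDerivAt_expConv ha (continuous_expConv hb hf) x).congr_deriv ?_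
  have hab' : a - b ≠ 0 := sub_ne_zero.2 hab
  rw [expConv_expConv ha hb hab hf]
  field_simp
  ring

lemma continuousAt_expConv_param {a : ℝ} (ha : 0 < a) {f : ℝ → ℝ} (hf : Continuous f) (x : ℝ) :
    ContinuousAt (fun s => expConv s f x) a := by
  have h1 : Continuous fun m : ℝ => ∫ y in (0:ℝ)..x, Real.exp (y * m) * f y :=
    intervalIntegral.continuous_parametric_intervalIntegral_of_continuous' (by fun_prop) 0 x
  have h2 : Continuous fun m : ℝ =>
      m * (Real.exp (-x * m) * ∫ y in (0:ℝ)..x, Real.exp (y * m) * f y) := by fun_prop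
  exact h2.continuousAt.comp (continuousAt_inv₀ ha.ne')

lemma hasDerivAt_mul_expConv_param {a : ℝ} (ha : 0 < a) {f : ℝ → ℝ} (hf : Continuous f) (x : ℝ) :
    HasDerivAt (fun s => s * expConv s f x) (expConv a (expConv a f) x) a := by
  rw [hasDerivAt_iff_tendsto_slope]
  have h := (continuousAt_expConv_param ha (continuous_expConv ha hf) x).tendsto
  refine (h.mono_left nhdsWithin_le_nhds).congr' ?_
  have hpos : ∀ᶠ s in nhdsWithin a {a}ᶜ, 0 < s := nhdsWithin_le_nhds (lt_mem_nhds ha)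
  filter_upwards [hpos, self_mem_nhdsWithin] with s hs hsa
  rw [expConv_expConv hs ha hsa hf, slope_def_field]

/-- The first-order condition for redistributing mass between two unequal weights. -/
lemma expConv_stationary {a b : ℝ} (ha : 0 < a) (hb : 0 < b) (hab : a ≠ b) {f : ℝ → ℝ}
    (hf : Continuous f) (x : ℝ)
    (hmin : ∀ a' b', 0 < a' → 0 < b' → a' + b' = a + b →
      expConv a (expConv b f) x ≤ expConv a' (expConv b' f) x) :
    expConv a (expConv a f) x + expConv b (expConv b f) x = 2 * expConv a (expConv b f) x := by
  have hab' : a - b ≠ 0 := sub_ne_zero.2 hab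
  set ψ : ℝ → ℝ := fun s =>
    (s * expConv s f x - (a + b - s) * expConv (a + b - s) f x) / (s - (a + b - s)) with hψ
  have hval : ∀ s, 0 < s → s < a + b → s ≠ a + b - s →
      ψ s = expConv s (expConv (a + b - s) f) x := fun s h1 h2 h3 =>
    (expConv_expConv h1 (by linarith) h3 hf x).symm
  have hloc : IsLocalMin ψ a := by
    have e1 : ∀ᶠ s in nhds a, 0 < s := lt_mem_nhds ha
    have e2 : ∀ᶠ s in nhds a, s < a + b := gt_mem_nhds (by linarith)
    have e3 : ∀ᶠ s in nhds a, s - (a + b - s) ≠ 0 := by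
      have : ContinuousAt (fun s : ℝ => s - (a + b - s)) a := by fun_prop
      exact this.eventually_ne (by simpa using hab')
    filter_upwards [e1, e2, e3] with s h1 h2 h3
    rw [hval s h1 h2 (sub_ne_zero.1 h3), hval a ha (by linarith) (by simpa using hab)]
    simpa using hmin s (a + b - s) h1 (by linarith) (by ring)
  have hN : HasDerivAt (fun s => s * expConv s f x - (a + b - s) * expConv (a + b - s) f x)
      (expConv a (expConv a f) x + expConv b (expConv b f) x) a := by
    have hb' := hasDerivAt_mul_expConv_param hb hf x
    rw [show b = a + b - a by ring] at hb'
    have := (hasDerivAt_mul_expConv_param ha hf x).sub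
      (hb'.comp a ((hasDerivAt_id a).const_sub (a + b)))
    refine this.congr_deriv ?_
    simp
  have hD : HasDerivAt (fun s : ℝ => s - (a + b - s)) 2 a := by
    refine ((hasDerivAt_id a).sub ((hasDerivAt_id a).const_sub (a + b))).congr_deriv ?_
    norm_num
  have h := hloc.hasDerivAt_eq_zero (hN.div hD (by simpa using hab'))
  have hr := expConv_expConv ha hb hab hf x
  simp only [add_sub_cancel_left] at h
  rw [eq_div_iff hab'] at hr
  rw [div_eq_zero_iff, or_iff_left (pow_ne_zero 2 hab'), ← hr] at h
  apply mul_right_cancel₀ hab'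
  linear_combination h

/-- A continuous function on the half-line that is positive and log-concave on the open half-line;
`p` is its logarithmic derivative. -/
structure IsLogConcaveDensity (d : ℝ → ℝ) : Prop where
  continuous : Continuous d
  nonneg_zero : 0 ≤ d 0
  pos : ∀ x, 0 < x → 0 < d x
  exists_logDeriv : ∃ p : ℝ → ℝ, AntitoneOn p (Set.Ioi 0) ∧ ∀ x, 0 < x → HasDerivAt d (p x * d x) x

lemma expConv_pos {a : ℝ} (ha : 0 < a) {d : ℝ → ℝ} (hd : IsLogConcaveDensity d) {x : ℝ}
    (hx : 0 < x) : 0 < expConv a d x := by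
  have hdc := hd.continuous
  have : 0 < ∫ y in (0:ℝ)..x, Real.exp (y / a) * d y := by
    refine intervalIntegral.intervalIntegral_pos_of_pos_on ?_ ?_ hx
    · exact Continuous.intervalIntegrable (by fun_prop) _ _
    · intro y hy
      have := hd.pos y hy.1
      positivity
  unfold expConv
  positivity

/-- Smoothing by an exponential makes log-concavity strict. -/
lemma logDeriv_mul_expConv_lt {a : ℝ} (ha : 0 < a) {d p : ℝ → ℝ} (hd : IsLogConcaveDensity d)
    (hp : AntitoneOn p (Set.Ioi 0)) (hdp : ∀ x, 0 < x → HasDerivAt d (p x * d x) x) {x : ℝ}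
    (hx : 0 < x) : (p x + 1 / a) * expConv a d x < d x / a := by
  have hdc := hd.continuous
  set C := p x + 1 / a with hC
  set u : ℝ → ℝ := fun y => Real.exp (y / a) * d y with hu
  have huc : Continuous u := by fun_prop
  set U : ℝ → ℝ := fun x => ∫ y in (0:ℝ)..x, u y with hU
  have hUd : ∀ y, HasDerivAt U (u y) y := fun y => (huc.integral_hasStrictDerivAt 0 y).hasDerivAt
  have hud : ∀ y, 0 < y → HasDerivAt u ((p y + 1 / a) * u y) y := by
    intro y hy
    have h2 : HasDerivAt (fun x : ℝ => Real.exp (x / a)) (Real.exp (y / a) * (1 / a)) y :=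
      ((hasDerivAt_id y).div_const a).exp
    refine (h2.mul (hdp y hy)).congr_deriv ?_
    simp only [hu]; ring
  have hUc : Continuous U := continuous_iff_continuousAt.2 fun x => (hUd x).continuousAt
  have hUg : expConv a d x = a⁻¹ * (Real.exp (-x / a) * U x) := rfl
  have h3 : Real.exp (-x / a) * Real.exp (x / a) = 1 := by
    rw [← Real.exp_add]; simp [neg_div]
  have hgpos := expConv_pos ha hd hx
  have hVmono : MonotoneOn (fun y => u y - C * U y) (Set.Icc 0 x) := by
    refine monotoneOn_of_hasDerivWithinAt_nonneg (f' := fun y => (p y + 1 / a) * u y - C * u y)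
      (convex_Icc 0 x) (by fun_prop) ?_ ?_
    · intro y hy
      rw [interior_Icc] at hy
      exact ((hud y hy.1).sub ((hUd y).const_mul C)).hasDerivWithinAt
    · intro y hy
      rw [interior_Icc] at hy
      have h1 := hp hy.1 (Set.mem_Ioi.2 hx) hy.2.le
      have h2 : 0 ≤ u y := mul_nonneg (Real.exp_pos _).le (hd.pos y hy.1).le
      have : 0 ≤ (p y - p x) * u y := mul_nonneg (by linarith) h2
      simp only [hC]; linarith
  have hU0 : U 0 = 0 := by simp [hU]
  have hV0 : 0 ≤ u 0 - C * U 0 := by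
    rw [hU0]; simpa [hu] using hd.nonneg_zero
  have key : C * U x < u x := by
    by_contra! hle
    have hzero : ∀ y ∈ Set.Icc 0 x, u y = C * U y := by
      intro y hy
      have h1 := hVmono (Set.left_mem_Icc.2 hx.le) hy hy.1
      have h2 := hVmono hy (Set.right_mem_Icc.2 hx.le) hy.2
      simp only at h1 h2
      linarith
    have hW : ∀ y, HasDerivAt (fun y => Real.exp (-C * y) * U y)
        (Real.exp (-C * y) * (u y - C * U y)) y := by
      intro y
      have h2 : HasDerivAt (fun y : ℝ => Real.exp (-C * y)) (Real.exp (-C * y) * (-C * 1)) y :=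
        ((hasDerivAt_id y).const_mul (-C)).exp
      refine (h2.mul (hUd y)).congr_deriv ?_
      ring
    have := constant_of_has_deriv_right_zero (f := fun y => Real.exp (-C * y) * U y)
      (a := 0) (b := x) (by fun_prop)
      (fun y hy => by
        have := (hW y).hasDerivWithinAt (s := Set.Ici y)
        rwa [hzero y ⟨hy.1, hy.2.le⟩, sub_self, mul_zero] at this) x (Set.right_mem_Icc.2 hx.le)
    simp only [hU0, mul_zero, mul_eq_zero, Real.exp_ne_zero, false_or] at this
    rw [hUg, this] at hgpos
    simp at hgpos
  have hE := Real.exp_pos (-x / a)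
  have h4 : Real.exp (-x / a) * (C * U x) < d x := by
    calc _ < Real.exp (-x / a) * u x := mul_lt_mul_of_pos_left key hE
      _ = d x := by simp only [hu]; rw [← mul_assoc, h3, one_mul]
  rw [hUg, lt_div_iff₀ ha]
  calc _ = Real.exp (-x / a) * (C * U x) := by field_simp
    _ < _ := h4

lemma IsLogConcaveDensity.expConv {a : ℝ} (ha : 0 < a) {d : ℝ → ℝ} (hd : IsLogConcaveDensity d) :
    IsLogConcaveDensity (expConv a d) := by
  obtain ⟨p, hp, hdp⟩ := hd.exists_logDeriv
  have hpos : ∀ x, 0 < x → 0 < _root_.expConv a d x := fun x hx => expConv_pos ha hd hx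
  have hg := hasDerivAt_expConv ha hd.continuous
  refine ⟨continuous_expConv ha hd.continuous, (expConv_zero a d).ge, hpos,
    fun x => (d x / _root_.expConv a d x - 1) / a, ?_, ?_⟩
  · have hder : ∀ x ∈ Set.Ioi (0:ℝ), HasDerivAt
        (fun x => (d x / _root_.expConv a d x - 1) / a) _ x := fun x hx =>
      (((hdp x hx).div (hg x) (hpos x hx).ne').sub_const 1).div_const a
    refine antitoneOn_of_hasDerivWithinAt_nonpos (convex_Ioi 0)
      (fun x hx => (hder x hx).continuousAt.continuousWithinAt)
      (fun x hx => (hder x (interior_subset hx)).hasDerivWithinAt) fun x hx => ?_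
    have hx' : 0 < x := by simpa using hx
    have h1 := logDeriv_mul_expConv_lt ha hd hp hdp hx'
    have h2 := hd.pos x hx'
    refine div_nonpos_of_nonpos_of_nonneg (div_nonpos_of_nonpos_of_nonneg ?_ (sq_nonneg _)) ha.le
    have h3 := mul_le_mul_of_nonneg_left h1.le h2.le
    have h4 : d x * ((p x + 1 / a) * _root_.expConv a d x) - d x * (d x / a) ≤ 0 := by linarith
    refine le_of_eq_of_le ?_ h4
    ring
  · intro x hx
    refine (hg x).congr_deriv ?_
    have := (hpos x hx).ne'
    field_simp

/-- A function vanishing at the origin with a log-concave derivative. -/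
def HasLogConcaveDensity (f : ℝ → ℝ) : Prop :=
  f 0 = 0 ∧ ∃ d, IsLogConcaveDensity d ∧ ∀ x, HasDerivAt f (d x) x

lemma HasLogConcaveDensity.expConv {a : ℝ} (ha : 0 < a) {f : ℝ → ℝ} (hf : HasLogConcaveDensity f) :
    HasLogConcaveDensity (expConv a f) := by
  obtain ⟨h0, d, hd, hfd⟩ := hf
  exact ⟨expConv_zero a f, _, hd.expConv ha, hasDerivAt_expConv_of_zero ha h0 hfd hd.continuous⟩

lemma hasLogConcaveDensity_expConv_one {a : ℝ} (ha : 0 < a) :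
    HasLogConcaveDensity (expConv a fun _ => 1) := by
  have hd : ∀ x, HasDerivAt (fun x : ℝ => Real.exp (-x / a)) (Real.exp (-x / a) * (-1 / a)) x :=
    fun x => ((hasDerivAt_id x).neg.div_const a).exp
  have he : (fun x => 1 - Real.exp (-x / a)) = expConv a fun _ => 1 := by
    refine eq_expConv ha continuous_const (by simp) fun x => ((hd x).const_sub 1).congr_deriv ?_
    ring
  refine ⟨expConv_zero _ _, fun x => Real.exp (-x / a) / a, ⟨by fun_prop, by positivity,
    fun x _ => by positivity, fun _ => -1 / a, antitoneOn_const, fun x _ => ?_⟩, fun x => ?_⟩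
  · exact ((hd x).div_const a).congr_deriv (by ring)
  · rw [← he]
    exact ((hd x).const_sub 1).congr_deriv (by ring)

lemma expConv_lt_of_hasDerivAt_zero {γ : ℝ → ℝ} (hγ : IsLogConcaveDensity γ) {a x : ℝ}
    (ha : 0 < a) (hx : 0 < x) (hγx : HasDerivAt γ 0 x) : expConv a γ x < γ x := by
  obtain ⟨p, hp, hdp⟩ := hγ.exists_logDeriv
  have h := logDeriv_mul_expConv_lt ha hγ hp hdp hx
  have h0 : p x = 0 := by
    simpa [(hγ.pos x hx).ne'] using (hdp x hx).unique hγx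
  rw [h0, zero_add, one_div, inv_mul_eq_div] at h
  exact (div_lt_div_iff_of_pos_right ha).1 h

lemma exists_hasDerivAt_expConv_sq {a b : ℝ} (ha : 0 < a) (hb : 0 < b) (hab : a ≠ b) {f : ℝ → ℝ}
    (hf : Continuous f) (x : ℝ)
    (hx : expConv a (expConv a f) x + expConv b (expConv b f) x = 2 * expConv a (expConv b f) x) :
    ∃ γ : ℝ → ℝ, (∀ y, HasDerivAt (expConv a (expConv b (expConv a (expConv b f)))) (γ y) y) ∧
      HasDerivAt γ 0 x := by
  set w : ℝ → ℝ := fun y => (expConv b f y - expConv a f y) / (a - b) with hw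
  have hca := continuous_expConv ha hf
  have hcb := continuous_expConv hb hf
  have hwc : Continuous w := by fun_prop
  refine ⟨expConv a (expConv b w), hasDerivAt_expConv_of_zero ha (expConv_zero _ _)
    (hasDerivAt_expConv_of_zero hb (expConv_zero _ _)
      (hasDerivAt_expConv_expConv ha hb hab hf) hwc) (continuous_expConv hb hwc), ?_⟩
  refine (hasDerivAt_expConv_expConv ha hb hab hwc x).congr_deriv ?_
  have hw' : ∀ s, 0 < s → expConv s w x =
      (expConv s (expConv b f) x - expConv s (expConv a f) x) / (a - b) := fun s hs => by
    rw [hw, expConv_div_const hs (by fun_prop), expConv_sub hs hcb hca]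
  rw [hw' a ha, hw' b hb, expConv_comm hb ha hf]
  rw [← sub_div, div_div]
  have : expConv b (expConv b f) x - expConv a (expConv b f) x -
    (expConv a (expConv b f) x - expConv a (expConv a f) x) = 0 := by linarith
  rw [this, zero_div]

lemma expConv_not_stationary_of_three {a b c : ℝ} (ha : 0 < a) (hb : 0 < b) (hc : 0 < c)
    (hab : a ≠ b) (hbc : b ≠ c) (hac : a ≠ c) {f : ℝ → ℝ} (hf : Continuous f)
    (hfa : HasLogConcaveDensity (expConv a f)) {x : ℝ} (hx : 0 < x)
    (h₁ : expConv a (expConv a (expConv c f)) x + expConv b (expConv b (expConv c f)) x =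
      2 * expConv a (expConv b (expConv c f)) x)
    (h₂ : expConv b (expConv b (expConv a f)) x + expConv c (expConv c (expConv a f)) x =
      2 * expConv b (expConv c (expConv a f)) x) : False := by
  obtain ⟨ε, hE, hε⟩ := exists_hasDerivAt_expConv_sq ha hb hab (continuous_expConv hc hf) x h₁
  obtain ⟨γ, hG, hγ⟩ := exists_hasDerivAt_expConv_sq hb hc hbc (continuous_expConv ha hf) x h₂
  set E := expConv a (expConv b (expConv a (expConv b (expConv c f)))) with hEdef
  set G := expConv b (expConv c (expConv b (expConv c (expConv a f)))) with hGdef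
  have hEc : Continuous E := continuous_iff_continuousAt.2 fun y => (hE y).continuousAt
  have hGc : Continuous G := continuous_iff_continuousAt.2 fun y => (hG y).continuousAt
  have hQ : expConv c E = expConv a G := by
    have c1 := continuous_expConv hc hf
    have c2 := continuous_expConv hb c1
    have c3 := continuous_expConv ha c2
    have c4 := continuous_expConv hb c3
    rw [hEdef, hGdef, expConv_comm hc ha c4, expConv_comm hc hb c3, expConv_comm hc ha c2,
      expConv_comm hc ha hf, expConv_comm hb ha c1,
      expConv_comm hc ha c2]
  obtain ⟨-, d, hd, hGd⟩ := ((((hfa.expConv hc).expConv hb).expConv hc).expConv hb)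
  obtain rfl : d = γ := funext fun y => (hGd y).unique (hG y)
  set Q := expConv a G with hQdef
  have hQ1 : ∀ y, HasDerivAt Q ((G y - Q y) / a) y := hasDerivAt_expConv ha hGc
  have hQ2 : ∀ y, HasDerivAt Q ((E y - Q y) / c) y := by
    rw [← hQ]; exact hasDerivAt_expConv hc hEc
  set Q' := expConv a d with hQ'def
  have hQ3 : ∀ y, HasDerivAt Q (Q' y) y :=
    hasDerivAt_expConv_of_zero ha (expConv_zero _ _) hG hd.continuous
  have hQ'1 : ∀ y, HasDerivAt Q' ((d y - Q' y) / a) y := hasDerivAt_expConv ha hd.continuous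
  have hQ'2 : ∀ y, HasDerivAt Q' ((ε y - Q' y) / c) y := fun y => by
    have : Q' = fun y => (E y - Q y) / c := funext fun y => (hQ3 y).unique (hQ2 y)
    refine HasDerivAt.congr_deriv ?_ (f' := (ε y - Q' y) / c) rfl
    nth_rw 1 [this]
    exact ((hE y).sub (hQ3 y)).div_const c
  have heq : (fun y => (d y - Q' y) / a) = fun y => (ε y - Q' y) / c :=
    funext fun y => (hQ'1 y).unique (hQ'2 y)
  have hd1 := (hγ.sub (hQ'1 x)).div_const a
  have hd2 := (hε.sub (hQ'1 x)).div_const c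
  have h := hd1.unique (heq ▸ hd2)
  have hlt : Q' x < d x := expConv_lt_of_hasDerivAt_zero hd ha hx hγ
  have hpos : 0 < (d x - Q' x) / a := div_pos (by linarith) ha
  rw [zero_sub, div_eq_div_iff ha.ne' hc.ne'] at h
  exact hac (mul_left_cancel₀ (neg_ne_zero.2 hpos.ne') h).symm

/-- For nonnegative weights `L`, on the half-line `[0, ∞)` this is the distribution function of the
`L`-weighted sum of i.i.d. `Exp(1)` variables. -/
noncomputable def expSumCDF : List ℝ → ℝ → ℝ
  | [] => fun _ => 1
  | a :: L => if a = 0 then expSumCDF L else expConv a (expSumCDF L)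

lemma expSumCDF_zero_cons (L : List ℝ) : expSumCDF (0 :: L) = expSumCDF L := by
  simp [expSumCDF]

lemma expSumCDF_cons {a : ℝ} (ha : 0 < a) (L : List ℝ) :
    expSumCDF (a :: L) = expConv a (expSumCDF L) := by
  simp [expSumCDF, ha.ne']

lemma continuous_expSumCDF {L : List ℝ} (hL : ∀ a ∈ L, 0 ≤ a) : Continuous (expSumCDF L) := by
  induction L with
  | nil => exact continuous_const
  | cons a L ih =>
    rw [List.forall_mem_cons] at hL
    rcases hL.1.eq_or_lt with rfl | ha
    · rw [expSumCDF_zero_cons]; exact ih hL.2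
    · rw [expSumCDF_cons ha]; exact continuous_expConv ha (ih hL.2)

lemma expSumCDF_perm {L L' : List ℝ} (h : L.Perm L') (hL : ∀ a ∈ L, 0 ≤ a) :
    expSumCDF L = expSumCDF L' := by
  induction h with
  | nil => rfl
  | cons a _ ih =>
    rw [List.forall_mem_cons] at hL
    simp only [expSumCDF, ih hL.2]
  | swap a b L =>
    simp only [List.forall_mem_cons] at hL
    obtain ⟨hb, ha, hL⟩ := hL
    rcases ha.eq_or_lt with rfl | ha
    · simp [expSumCDF]
    rcases hb.eq_or_lt with rfl | hb
    · simp [expSumCDF]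
    simp only [expSumCDF_cons ha, expSumCDF_cons hb]
    exact expConv_comm hb ha (continuous_expSumCDF hL)
  | trans h₁ _ ih₁ ih₂ =>
    rw [ih₁ hL, ih₂ fun a ha => hL a (h₁.mem_iff.2 ha)]

lemma hasLogConcaveDensity_expConv_expSumCDF {a : ℝ} (ha : 0 < a) {L : List ℝ}
    (hL : ∀ a ∈ L, 0 ≤ a) : HasLogConcaveDensity (expConv a (expSumCDF L)) := by
  induction L with
  | nil => exact hasLogConcaveDensity_expConv_one ha
  | cons e L ih =>
    rw [List.forall_mem_cons] at hL
    rcases hL.1.eq_or_lt with rfl | he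
    · rw [expSumCDF_zero_cons]; exact ih hL.2
    · rw [expSumCDF_cons he, expConv_comm ha he (continuous_expSumCDF hL.2)]
      exact (ih hL.2).expConv he

lemma expSumCDF_minimizer_not_three {L M : List ℝ} {a b c x : ℝ} (ha : 0 < a) (hb : 0 < b)
    (hc : 0 < c) (hab : a ≠ b) (hbc : b ≠ c) (hac : a ≠ c) (hM : ∀ a ∈ M, 0 ≤ a) (hx : 0 < x)
    (hL : L.Perm (a :: b :: c :: M))
    (hmin : ∀ L' : List ℝ, L'.length = L.length → (∀ a ∈ L', 0 ≤ a) → L'.sum = L.sum →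
      expSumCDF L x ≤ expSumCDF L' x) : False := by
  have hMc := continuous_expSumCDF hM
  have key : ∀ a b c : ℝ, 0 < a → 0 < b → 0 < c → a ≠ b → L.Perm (a :: b :: c :: M) →
      expConv a (expConv a (expConv c (expSumCDF M))) x +
        expConv b (expConv b (expConv c (expSumCDF M))) x =
      2 * expConv a (expConv b (expConv c (expSumCDF M))) x := by
    intro a b c ha hb hc hab hL
    refine expConv_stationary ha hb hab (continuous_expConv hc hMc) x fun a' b' ha' hb' hs => ?_
    have h := hmin (a' :: b' :: c :: M) (by simp [hL.length_eq])
      (by simpa [ha'.le, hb'.le, hc.le] using hM)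
      (by rw [hL.sum_eq]; simp only [List.sum_cons]; linarith)
    have hL0 : ∀ e ∈ L, 0 ≤ e := fun e he => by
      have h' : ∀ e ∈ a :: b :: c :: M, 0 ≤ e := by simpa [ha.le, hb.le, hc.le] using hM
      exact h' e (hL.mem_iff.1 he)
    rw [expSumCDF_perm hL hL0] at h
    simpa only [expSumCDF_cons, ha, hb, hc, ha', hb'] using h
  refine expConv_not_stationary_of_three ha hb hc hab hbc hac hMc
    (hasLogConcaveDensity_expConv_expSumCDF ha hM) hx (key a b c ha hb hc hab hL)
    (key b c a hb hc ha hbc (hL.trans ?_))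
  exact (List.Perm.swap b a _).trans ((List.Perm.swap c a M).cons b)

lemma integral_expMeasure_one (g : ℝ → ℝ) :
    ∫ z, g z ∂expMeasure 1 = ∫ z in Set.Ioi (0:ℝ), Real.exp (-z) * g z := by
  have hm : Measurable (gammaPDF 1 1) := (measurable_gammaPDFReal 1 1).ennreal_ofReal
  rw [expMeasure, gammaMeasure, integral_withDensity_eq_integral_toReal_smul hm
    (ae_of_all _ fun _ => ENNReal.ofReal_lt_top), ← integral_Ici_eq_integral_Ioi,
    ← MeasureTheory.integral_indicator measurableSet_Ici]
  congr 1
  funext z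
  by_cases hz : 0 ≤ z
  · rw [Set.indicator_of_mem (Set.mem_Ici.2 hz), gammaPDF_of_nonneg hz]
    simp [ENNReal.toReal_ofReal (Real.exp_pos _).le]
  · rw [Set.indicator_of_notMem (by simpa using hz), gammaPDF_of_neg (not_le.1 hz)]
    simp

lemma outage_succ (n : ℕ) (x : ℝ) (q : Fin (n + 1) → ℝ) :
    outage (n + 1) x q = ∫ z, outage n (x - q 0 * z) (Fin.tail q) ∂expMeasure 1 := by
  have := isProbabilityMeasure_expMeasure one_pos
  have hmp := (measurePreserving_piFinSuccAbove (fun _ : Fin (n + 1) => expMeasure 1) 0).symm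
  have hS : MeasurableSet {v : Fin (n + 1) → ℝ | ∑ i, q i * v i ≤ x} :=
    measurableSet_le (by fun_prop) (by fun_prop)
  have hS' := hmp.measurable hS
  rw [outage, expLaw, ← hmp.measure_preimage_equiv, Measure.prod_apply hS', ← integral_toReal
    (measurable_measure_prodMk_left hS').aemeasurable (ae_of_all _ fun _ => measure_lt_top _ _)]
  congr 1
  funext z
  simp only [outage, expLaw]
  congr 2
  ext v
  simp [Fin.sum_univ_succ, Fin.tail, le_sub_iff_add_le']

lemma integral_exp_mul_eq_expConv {a x : ℝ} (ha : 0 < a) (hx : 0 ≤ x) (F : ℝ → ℝ) :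
    ∫ z in Set.Ioi (0:ℝ), Real.exp (-z) * (if 0 ≤ x - a * z then F (x - a * z) else 0) =
      expConv a F x := by
  have h1 : ∫ z in Set.Ioi (0:ℝ), Real.exp (-z) * (if 0 ≤ x - a * z then F (x - a * z) else 0) =
      ∫ z in (0:ℝ)..x / a, Real.exp (-z) * F (x - a * z) := by
    rw [intervalIntegral.integral_of_le (by positivity),
      ← MeasureTheory.integral_indicator measurableSet_Ioi,
      ← MeasureTheory.integral_indicator measurableSet_Ioc]
    congr 1
    funext z
    have hz : 0 ≤ x - a * z ↔ z ≤ x / a := by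
      rw [le_div_iff₀ ha, sub_nonneg, mul_comm]
    by_cases h0 : 0 < z <;> by_cases h1 : z ≤ x / a <;> simp [Set.indicator, h0, h1, hz]
  have h2 : ∀ z, Real.exp (-z) * F (x - a * z) =
      (fun y => Real.exp (-x / a) * (Real.exp (y / a) * F y)) (x - a * z) := fun z => by
    have : -z = -x / a + (x - a * z) / a := by field_simp; ring
    rw [this, Real.exp_add]
    ring
  rw [h1]
  simp only [h2]
  rw [intervalIntegral.integral_comp_sub_mul
    (fun y => Real.exp (-x / a) * (Real.exp (y / a) * F y)) ha.ne',
    mul_div_cancel₀ _ ha.ne', sub_self, mul_zero, sub_zero, intervalIntegral.integral_const_mul]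
  rfl

lemma outage_eq_expSumCDF (n : ℕ) (q : Fin n → ℝ) (hq : ∀ i, 0 ≤ q i) (x : ℝ) :
    outage n x q = if 0 ≤ x then expSumCDF (List.ofFn q) x else 0 := by
  have := isProbabilityMeasure_expMeasure one_pos
  induction n generalizing x with
  | zero =>
    by_cases hx : 0 ≤ x <;> simp [outage, expLaw, hx, expSumCDF]
  | succ n ih =>
    have ih' := ih (Fin.tail q) fun i => hq i.succ
    rw [outage_succ, List.ofFn_succ]
    simp_rw [ih']
    rcases (hq 0).eq_or_lt with h0 | h0
    · simp [← h0, expSumCDF_zero_cons, Fin.tail_def]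
    · rw [integral_expMeasure_one]
      split_ifs with hx
      · rw [integral_exp_mul_eq_expConv h0 hx, expSumCDF_cons h0]
        rfl
      · refine setIntegral_eq_zero_of_forall_eq_zero fun z hz => ?_
        have : ¬ 0 ≤ x - q 0 * z := by
          have := mul_pos h0 (show (0:ℝ) < z from hz)
          linarith
        simp [this]

lemma exists_perm_of_three_mem {L : List ℝ} {a b c : ℝ} (ha : a ∈ L) (hb : b ∈ L) (hc : c ∈ L)
    (hab : a ≠ b) (hbc : b ≠ c) (hac : a ≠ c) : ∃ M, L.Perm (a :: b :: c :: M) := by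
  have hb' : b ∈ L.erase a := (List.mem_erase_of_ne hab.symm).2 hb
  have hc' : c ∈ (L.erase a).erase b :=
    (List.mem_erase_of_ne hbc.symm).2 ((List.mem_erase_of_ne hac.symm).2 hc)
  exact ⟨_, (List.perm_cons_erase ha).trans (((List.perm_cons_erase hb').trans
    ((List.perm_cons_erase hc').cons b)).cons a)⟩

lemma minimizer_not_three {t : ℕ} {x : ℝ} (hx : 0 < x) {q : Fin t → ℝ} (hq : q ∈ simplexEq t)
    (hmin : ∀ q' ∈ simplexEq t, outage t x q ≤ outage t x q') (i j k : Fin t)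
    (hi : q i ≠ 0) (hj : q j ≠ 0) (hk : q k ≠ 0) (hij : q i ≠ q j) (hjk : q j ≠ q k)
    (hik : q i ≠ q k) : False := by
  have hmem : ∀ i, q i ∈ List.ofFn q := fun i => List.mem_ofFn.2 ⟨i, rfl⟩
  obtain ⟨M, hM⟩ := exists_perm_of_three_mem (hmem i) (hmem j) (hmem k) hij hjk hik
  have hnonneg : ∀ a ∈ List.ofFn q, 0 ≤ a := fun a ha => by
    obtain ⟨l, rfl⟩ := List.mem_ofFn.1 ha
    exact hq.1 l
  refine expSumCDF_minimizer_not_three ((hq.1 i).lt_of_ne' hi) ((hq.1 j).lt_of_ne' hj)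
    ((hq.1 k).lt_of_ne' hk) hij hjk hik (fun a ha => hnonneg a (hM.mem_iff.2 (by simp [ha]))) hx hM
    fun L' hlen hL' hsum => ?_
  rw [List.length_ofFn] at hlen
  subst hlen
  have hq' : L'.get ∈ simplexEq L'.length := by
    refine ⟨fun i => hL' _ (List.get_mem _ _), ?_⟩
    rw [← List.sum_ofFn, List.ofFn_get, hsum, List.sum_ofFn, hq.2]
  have h := hmin _ hq'
  rwa [outage_eq_expSumCDF _ _ hq.1, outage_eq_expSumCDF _ _ hq'.1, if_pos hx.le, if_pos hx.le,
    List.ofFn_get] at h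

/-- A function taking only the values `p₁ ≠ p₂` and `0` can be rearranged into blocks. -/
lemma exists_perm_blocks {t : ℕ} (q : Fin t → ℝ) {p₁ p₂ : ℝ} (hp : p₁ ≠ p₂)
    (hq : ∀ i, q i = p₁ ∨ q i = p₂ ∨ q i = 0) :
    #{i | q i = p₁} + #{i | q i = p₂} ≤ t ∧ ∃ σ : Equiv.Perm (Fin t), ∀ i : Fin t,
      q (σ i) = if (i : ℕ) < #{i | q i = p₁} then p₁
        else if (i : ℕ) < #{i | q i = p₁} + #{i | q i = p₂} then p₂ else 0 := by
  classical
  set k := #{i | q i = p₁} with hk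
  set l := #{i | q i = p₂} with hl
  let u : Fin t → Fin 3 := fun i => if (i : ℕ) < k then 0 else if (i : ℕ) < k + l then 1 else 2
  let v : Fin t → Fin 3 := fun i => if q i = p₁ then 0 else if q i = p₂ then 1 else 2
  have hkl : k + l ≤ t := by
    rw [hk, hl, ← card_union_of_disjoint]
    · simpa using card_le_univ (({i | q i = p₁} : Finset (Fin t)) ∪ ({i | q i = p₂} : Finset _))
    · rw [Finset.disjoint_left]
      intro i h1 h2
      simp only [mem_filter, mem_univ, true_and] at h1 h2
      exact hp (h1.symm.trans h2)
  have hu0 : #{i | u i = 0} = k := by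
    have : ({i | u i = 0} : Finset (Fin t)) = ({i : Fin t | (i : ℕ) < k} : Finset _) := by
      ext i; simp only [u, mem_filter, mem_univ, true_and]; split_ifs <;> simp_all
    rw [this, Fin.card_filter_val_lt]; omega
  have hu1 : #{i | u i = 0} + #{i | u i = 1} = k + l := by
    rw [← card_union_of_disjoint (by
      rw [Finset.disjoint_left]; intro i h1 h2; simp_all)]
    have : ({i | u i = 0} : Finset (Fin t)) ∪ ({i | u i = 1} : Finset _) =
        ({i : Fin t | (i : ℕ) < k + l} : Finset _) := by
      ext i
      simp only [u, mem_filter, mem_univ, true_and, mem_union]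
      split_ifs <;> simp <;> omega
    rw [this, Fin.card_filter_val_lt]; omega
  have hv0 : #{i | v i = 0} = k := by
    congr 1; ext i; simp only [v, mem_filter, mem_univ, true_and]; split_ifs <;> simp_all
  have hv1 : #{i | v i = 1} = l := by
    congr 1; ext i; simp only [v, mem_filter, mem_univ, true_and]
    split_ifs with h1 h2 <;> simp_all
  have htot : ∀ w : Fin t → Fin 3, #{i | w i = 0} + #{i | w i = 1} + #{i | w i = 2} = t := by
    intro w
    have := card_eq_sum_card_fiberwise (f := w) (s := univ) (t := univ) (by simp)
    rw [Fin.sum_univ_three, card_univ, Fintype.card_fin] at this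
    exact this.symm
  have hcard : ∀ c, #{i | u i = c} = #{i | v i = c} := by
    have h1 := htot u
    have h2 := htot v
    intro c
    fin_cases c <;> simp only [Fin.reduceFinMk, Fin.zero_eta, Fin.mk_one] <;> omega
  let e : ∀ c, { i // u i = c } ≃ { i // v i = c } := fun c =>
    Fintype.equivOfCardEq (by rw [Fintype.card_subtype, Fintype.card_subtype, hcard])
  refine ⟨hkl, Equiv.ofFiberEquiv e, fun i => ?_⟩
  have h := Equiv.ofFiberEquiv_map e i
  generalize Equiv.ofFiberEquiv e i = j at h
  have := hq j
  simp only [u, v] at h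
  split_ifs at h ⊢ <;> simp_all

/-- for `x > 0`, any minimizer of `q ↦ P{⟨q,X⟩ ≤ x}` over `Θ(t)` takes at
most two distinct nonzero values: up to a permutation of coordinates it equals
`(p₁,…,p₁,p₂,…,p₂,0,…,0)` with `p₁` appearing `k` times, `p₂` appearing `l` times,
`k + l ≤ t`, `p₁, p₂ ∈ [0,1]` and `k·p₁ + l·p₂ = 1`. -/
theorem minimizer_has_at_most_two_values (t : ℕ) (ht : 1 ≤ t) (x : ℝ) (hx : 0 < x)
    (q : Fin t → ℝ) (hq_mem : q ∈ simplexEq t)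
    (hq_min : ∀ q' ∈ simplexEq t, outage t x q ≤ outage t x q') :
    ∃ (k l : ℕ) (p₁ p₂ : ℝ), k + l ≤ t ∧ p₁ ∈ Set.Icc (0:ℝ) 1 ∧ p₂ ∈ Set.Icc (0:ℝ) 1 ∧
      (k : ℝ) * p₁ + (l : ℝ) * p₂ = 1 ∧
      ∃ σ : Equiv.Perm (Fin t), ∀ i : Fin t,
        q (σ i) = if (i : ℕ) < k then p₁ else if (i : ℕ) < k + l then p₂ else 0 := by
  have hIcc : ∀ i, q i ∈ Set.Icc (0:ℝ) 1 := fun i =>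
    ⟨hq_mem.1 i, hq_mem.2 ▸ single_le_sum (fun j _ => hq_mem.1 j) (mem_univ i)⟩
  obtain ⟨p₁, p₂, hp₁, hp₂, hp, hq⟩ : ∃ p₁ p₂ : ℝ, p₁ ∈ Set.Icc (0:ℝ) 1 ∧ p₂ ∈ Set.Icc (0:ℝ) 1 ∧
      p₁ ≠ p₂ ∧ ∀ i, q i = p₁ ∨ q i = p₂ ∨ q i = 0 := by
    obtain ⟨i, hi⟩ : ∃ i, q i ≠ 0 := by
      by_contra! h
      simpa [h] using hq_mem.2
    by_cases h : ∃ j, q j ≠ 0 ∧ q i ≠ q j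
    · obtain ⟨j, hj, hij⟩ := h
      refine ⟨q i, q j, hIcc i, hIcc j, hij, fun k => ?_⟩
      by_contra! hk
      exact minimizer_not_three hx hq_mem hq_min i j k hi hj hk.2.2 hij hk.2.1.symm hk.1.symm
    · push Not at h
      refine ⟨q i, 0, hIcc i, by simp, hi, fun k => ?_⟩
      by_cases hk : q k = 0
      · exact Or.inr (Or.inl hk)
      · exact Or.inl (h k hk).symm
  obtain ⟨hle, σ, hσ⟩ := exists_perm_blocks q hp hq
  refine ⟨_, _, p₁, p₂, hle, hp₁, hp₂, ?_, σ, hσ⟩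
  have hsum : ∑ i, q i = ∑ i, ((if q i = p₁ then p₁ else 0) + if q i = p₂ then p₂ else 0) := by
    refine sum_congr rfl fun i _ => ?_
    have := hq i
    split_ifs <;> simp_all
  rw [hq_mem.2, sum_add_distrib, ← sum_filter, ← sum_filter, sum_const, sum_const, nsmul_eq_mul,
    nsmul_eq_mul] at hsum
  exact hsum.symm
end

section
/- Fix l ≥ 1 and x > 0, and for p ∈ [0, 1/(l+1)] let q(p) := (p, (1−p)/l, …, (1−p)/l, 0, …, 0) ∈ Θ(t) with (1−p)/l appearing l times. Then: (i) the derivative of p ↦ P{⟨q(p),X⟩ ≤ x} at p = 0 equals −(1/l) · f'_{(1/l) Σ_{i=1}^{l+1} X_i}(x), which is strictly negative if and only if x < 1; (ii) the second derivative of p ↦ P{⟨q(p),X⟩ ≤ x} at p = 1/(l+1) equals c(l) · e^{−(l+1)x} · (l+2 − (l+1)x) · x^{l+1} for some constant c(l) > 0 depending only on l, and hence is strictly positive if and only if x < (l+2)/(l+1). -/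
open MeasureTheory ProbabilityTheory Finset

/-- The curve `p ↦ q(p) = (p, (1−p)/l, …, (1−p)/l, 0, …, 0)` with `(1−p)/l` appearing `l`
times. -/
noncomputable def qCurve (t l : ℕ) (p : ℝ) : Fin t → ℝ :=
  fun i => if (i : ℕ) = 0 then p else if (i : ℕ) ≤ l then (1 - p) / l else 0


instance isProbabilityMeasure_expMeasure_one : IsProbabilityMeasure (expMeasure 1) :=
  isProbabilityMeasure_expMeasure one_pos

instance isProbabilityMeasure_gammaMeasure_nat_succ (n : ℕ) :
    IsProbabilityMeasure (gammaMeasure (n + 1) 1) :=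
  isProbabilityMeasure_gammaMeasure (by positivity) one_pos

instance isProbabilityMeasure_expLaw (t : ℕ) : IsProbabilityMeasure (expLaw t) := by
  unfold expLaw; infer_instance

lemma gammaPDFReal_nat_succ_one (n : ℕ) (y : ℝ) :
    gammaPDFReal (n + 1) 1 y =
      if 0 ≤ y then y ^ n / (n.factorial : ℝ) * Real.exp (-y) else 0 := by
  unfold gammaPDFReal
  split_ifs with h
  · rw [Real.Gamma_nat_eq_factorial, add_sub_cancel_right, Real.rpow_natCast, Real.one_rpow,
      one_mul]
    ring
  · rfl

/-- Adding an independent `Exp(1)` variable increments the shape of a `Γ(n + 1, 1)` variable. -/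
lemma gammaMeasure_conv_expMeasure (n : ℕ) :
    gammaMeasure (n + 1) 1 ∗ expMeasure 1 = gammaMeasure ((n + 1 : ℕ) + 1) 1 := by
  unfold expMeasure gammaMeasure
  have hm (a : ℝ) : Measurable (gammaPDF a 1) := (measurable_gammaPDFReal a 1).ennreal_ofReal
  rw [conv_withDensity_eq_lconvolution (hm _) (hm _)]
  congr 1
  ext x
  rw [lconvolution_def]
  have hpt (y : ℝ) : gammaPDF (n + 1) 1 y * gammaPDF 1 1 (-y + x) =
      (Set.Icc 0 x).indicator
        (fun y => ENNReal.ofReal (y ^ n / (n.factorial : ℝ) * Real.exp (-x))) y := by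
    have h1 := gammaPDFReal_nat_succ_one 0 (-y + x)
    simp only [Nat.cast_zero, zero_add, pow_zero, Nat.factorial_zero, Nat.cast_one, div_one,
      one_mul] at h1
    rw [gammaPDF, gammaPDF, gammaPDFReal_nat_succ_one, h1]
    by_cases hy : 0 ≤ y
    · by_cases hyx : y ≤ x
      · rw [Set.indicator_of_mem (Set.mem_Icc.2 ⟨hy, hyx⟩), if_pos hy, if_pos (by linarith),
          ← ENNReal.ofReal_mul (by positivity), mul_assoc, ← Real.exp_add]
        congr 4
        ring
      · rw [Set.indicator_of_notMem (fun h => hyx h.2), if_neg (c := 0 ≤ -y + x) (by linarith)]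
        simp
    · rw [Set.indicator_of_notMem (fun h => hy h.1), if_neg hy]
      simp
  simp_rw [hpt]
  rw [lintegral_indicator measurableSet_Icc, gammaPDF, gammaPDFReal_nat_succ_one]
  split_ifs with hx
  · rw [← ofReal_integral_eq_lintegral_ofReal]
    · rw [integral_Icc_eq_integral_Ioc, ← intervalIntegral.integral_of_le hx,
        intervalIntegral.integral_mul_const, intervalIntegral.integral_div, integral_pow,
        Nat.factorial_succ]
      congr 1
      have : (n.factorial : ℝ) ≠ 0 := by positivity
      push_cast
      field_simp
      simp
    · exact Continuous.integrableOn_Icc (by fun_prop)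
    · filter_upwards [ae_restrict_mem measurableSet_Icc] with y hy
      have := hy.1
      positivity
  · rw [Set.Icc_eq_empty hx]
    simp

lemma iIndepFun_eval_expLaw (t : ℕ) :
    iIndepFun (fun (i : Fin t) (v : Fin t → ℝ) => v i) (expLaw t) :=
  iIndepFun_pi (μ := fun _ : Fin t => expMeasure 1) (X := fun _ (y : ℝ) => y)
    fun _ => aemeasurable_id

lemma map_eval_expLaw {t : ℕ} (i : Fin t) :
    (expLaw t).map (fun v => v i) = expMeasure 1 :=
  (measurePreserving_eval (fun _ : Fin t => expMeasure 1) i).map_eq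

lemma map_sum_expLaw {t n : ℕ} {s : Finset (Fin t)} (hs : #s = n + 1) :
    (expLaw t).map (fun v => ∑ i ∈ s, v i) = gammaMeasure (n + 1) 1 := by
  induction n generalizing s with
  | zero =>
    obtain ⟨i, rfl⟩ := card_eq_one.1 hs
    simpa [expMeasure] using map_eval_expLaw i
  | succ n ih =>
    obtain ⟨i, s, hi, rfl, hs'⟩ := card_eq_succ.1 hs
    have hind := (iIndepFun_eval_expLaw t).indepFun_finsetSum_of_notMem
      (fun j => measurable_pi_apply j) hi
    have e1 : (∑ j ∈ s, fun v : Fin t → ℝ => v j) = fun v => ∑ j ∈ s, v j := by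
      ext v; simp
    rw [e1] at hind
    have h := hind.map_add_eq_map_conv_map (by fun_prop) (measurable_pi_apply i)
    rw [ih hs', map_eval_expLaw, gammaMeasure_conv_expMeasure] at h
    rw [← h]
    congr 1
    ext v
    simp [sum_insert hi, add_comm]

lemma map_eval_sum_expLaw {t n : ℕ} {s : Finset (Fin t)} {i : Fin t} (hi : i ∉ s)
    (hs : #s = n + 1) :
    (expLaw t).map (fun v => (v i, ∑ j ∈ s, v j)) =
      (expMeasure 1).prod (gammaMeasure (n + 1) 1) := by
  have hind := (iIndepFun_eval_expLaw t).indepFun_finsetSum_of_notMem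
    (fun j => measurable_pi_apply j) hi
  have e1 : (∑ j ∈ s, fun v : Fin t → ℝ => v j) = fun v => ∑ j ∈ s, v j := by
    ext v; simp
  rw [e1] at hind
  rw [(indepFun_iff_map_prod_eq_prod_map_map (measurable_pi_apply i).aemeasurable
    (by fun_prop)).1 hind.symm,
    map_eval_expLaw, map_sum_expLaw hs]

lemma outage_qCurve {t m : ℕ} (ht : m + 2 ≤ t) (x p : ℝ) :
    outage t x (qCurve t (m + 1) p) =
      (((expMeasure 1).prod (gammaMeasure (m + 1) 1))
        {z | p * z.1 + (1 - p) / (m + 1) * z.2 ≤ x}).toReal := by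
  set s : Finset (Fin t) := univ.filter fun i => (i : ℕ) ≠ 0 ∧ (i : ℕ) ≤ m + 1 with hs
  let i₀ : Fin t := ⟨0, by omega⟩
  have hi : i₀ ∉ s := by simp [hs, i₀]
  have hcard : #s = m + 1 := by
    have : s.map Fin.valEmbedding = Finset.Icc 1 (m + 1) := by
      ext j
      simp only [hs, mem_map, mem_filter, mem_univ, true_and, Fin.valEmbedding_apply,
        Finset.mem_Icc]
      constructor
      · rintro ⟨a, ha, rfl⟩
        omega
      · intro hj
        exact ⟨⟨j, by omega⟩, by simp; omega, rfl⟩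
    rw [← card_map Fin.valEmbedding, this]
    simp
  have hsum (v : Fin t → ℝ) : ∑ i, qCurve t (m + 1) p i * v i =
      p * v i₀ + (1 - p) / (m + 1) * ∑ i ∈ s, v i := by
    have hpt (i : Fin t) : qCurve t (m + 1) p i * v i =
        (if i = i₀ then p * v i else 0) +
          (if (i : ℕ) ≠ 0 ∧ (i : ℕ) ≤ m + 1 then (1 - p) / (m + 1) * v i else 0) := by
      have : i = i₀ ↔ (i : ℕ) = 0 := Fin.ext_iff
      unfold qCurve
      by_cases h0 : (i : ℕ) = 0 <;> by_cases h1 : (i : ℕ) ≤ m + 1 <;> simp [h0, h1, this]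
    simp_rw [hpt]
    rw [sum_add_distrib, sum_ite_eq' univ i₀, ← sum_filter, ← hs, mul_sum]
    simp
  rw [outage, ← map_eval_sum_expLaw hi hcard, Measure.map_apply (by fun_prop)
    (measurableSet_le (by fun_prop) (by fun_prop))]
  simp_rw [hsum]
  rfl

lemma integrable_gammaPDFReal_nat_succ (n : ℕ) : Integrable (gammaPDFReal (n + 1) 1) := by
  refine ⟨(measurable_gammaPDFReal _ _).aestronglyMeasurable, ?_⟩
  rw [hasFiniteIntegral_iff_ofReal
    (ae_of_all _ (gammaPDFReal_nonneg (by positivity) one_pos))]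
  have := lintegral_gammaPDF_eq_one (a := n + 1) (r := 1) (by positivity) one_pos
  unfold gammaPDF at this
  simp [this]

lemma gammaPDFReal_nat_succ_one_le_one (n : ℕ) (y : ℝ) : gammaPDFReal (n + 1) 1 y ≤ 1 := by
  rw [gammaPDFReal_nat_succ_one]
  split_ifs with h
  · calc y ^ n / (n.factorial : ℝ) * Real.exp (-y) ≤ Real.exp y * Real.exp (-y) := by
          gcongr
          exact Real.pow_div_factorial_le_exp y h n
      _ = 1 := by rw [← Real.exp_add]; simp
  · exact zero_le_one

lemma cdf_gammaMeasure_sub (n : ℕ) (a b : ℝ) :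
    cdf (gammaMeasure (n + 1) 1) b - cdf (gammaMeasure (n + 1) 1) a =
      ∫ y in a..b, gammaPDFReal (n + 1) 1 y := by
  rw [cdf_gammaMeasure_eq_integral (by positivity) one_pos,
    cdf_gammaMeasure_eq_integral (by positivity) one_pos]
  exact intervalIntegral.integral_Iic_sub_Iic (integrable_gammaPDFReal_nat_succ n).integrableOn
    (integrable_gammaPDFReal_nat_succ n).integrableOn

lemma abs_cdf_gammaMeasure_sub_le (n : ℕ) (a b : ℝ) :
    |cdf (gammaMeasure (n + 1) 1) b - cdf (gammaMeasure (n + 1) 1) a| ≤ |b - a| := by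
  rw [cdf_gammaMeasure_sub, ← Real.norm_eq_abs]
  simpa using intervalIntegral.norm_integral_le_of_norm_le_const (C := 1)
    (f := gammaPDFReal (n + 1) 1) (a := a) (b := b) fun y _ => by
      rw [Real.norm_of_nonneg (gammaPDFReal_nonneg (by positivity) one_pos y)]
      exact gammaPDFReal_nat_succ_one_le_one n y

lemma hasDerivAt_cdf_gammaMeasure (n : ℕ) {y : ℝ} (hy : 0 < y) :
    HasDerivAt (cdf (gammaMeasure (n + 1) 1))
      (y ^ n / (n.factorial : ℝ) * Real.exp (-y)) y := by
  have heq : (fun z => z ^ n / (n.factorial : ℝ) * Real.exp (-z)) =ᶠ[nhds y]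
      gammaPDFReal (n + 1) 1 := by
    filter_upwards [lt_mem_nhds hy] with z hz
    rw [gammaPDFReal_nat_succ_one, if_pos hz.le]
  have hcont : ContinuousAt (gammaPDFReal (n + 1) 1) y :=
    ContinuousAt.congr (Continuous.continuousAt (by fun_prop)) heq
  have h := intervalIntegral.integral_hasDerivAt_right (a := 0)
    (integrable_gammaPDFReal_nat_succ n).intervalIntegrable
    (stronglyMeasurable_gammaPDFReal (n + 1) 1).stronglyMeasurableAtFilter hcont
  rw [← heq.eq_of_nhds] at h
  simp_rw [← cdf_gammaMeasure_sub] at h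
  simpa using h.add_const (cdf (gammaMeasure (n + 1) 1) 0)

lemma integrable_id_expMeasure_one : Integrable (fun u : ℝ => u) (expMeasure 1) := by
  have hm : Measurable (gammaPDF 1 1) := (measurable_gammaPDFReal 1 1).ennreal_ofReal
  unfold expMeasure gammaMeasure
  rw [integrable_withDensity_iff hm (ae_of_all _ fun _ => ENNReal.ofReal_lt_top)]
  have h := integrable_gammaPDFReal_nat_succ 1
  convert! h using 2 with y
  have h0 := gammaPDFReal_nat_succ_one 0 y
  norm_num at h0
  rw [gammaPDFReal_nat_succ_one, gammaPDF,
    ENNReal.toReal_ofReal (gammaPDFReal_nonneg one_pos one_pos y), h0]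
  split_ifs <;> simp

lemma integral_id_expMeasure_one : ∫ u, u ∂(expMeasure 1) = 1 := by
  have hm : Measurable (gammaPDF 1 1) := (measurable_gammaPDFReal 1 1).ennreal_ofReal
  unfold expMeasure gammaMeasure
  rw [integral_withDensity_eq_integral_toReal_smul hm
    (ae_of_all _ fun _ => ENNReal.ofReal_lt_top)]
  have h : ∫ y, gammaPDFReal ((1 : ℕ) + 1) 1 y = 1 := by
    rw [integral_eq_lintegral_of_nonneg_ae
      (ae_of_all _ (gammaPDFReal_nonneg (by positivity) one_pos))
      (measurable_gammaPDFReal _ _).aestronglyMeasurable]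
    have := lintegral_gammaPDF_eq_one (a := (1 : ℕ) + 1) (r := 1) (by positivity) one_pos
    unfold gammaPDF at this
    rw [this, ENNReal.toReal_one]
  refine Eq.trans ?_ h
  congr 1 with y
  have h0 := gammaPDFReal_nat_succ_one 0 y
  norm_num at h0
  rw [gammaPDFReal_nat_succ_one, gammaPDF,
    ENNReal.toReal_ofReal (gammaPDFReal_nonneg one_pos one_pos y), h0]
  split_ifs <;> simp [mul_comm]

lemma outage_qCurve_eq_integral_cdf {t m : ℕ} (ht : m + 2 ≤ t) (x : ℝ) {p : ℝ} (hp : p < 1) :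
    outage t x (qCurve t (m + 1) p) =
      ∫ u, cdf (gammaMeasure (m + 1) 1) ((m + 1) * ((x - p * u) / (1 - p)))
        ∂(expMeasure 1) := by
  rw [outage_qCurve ht, Measure.prod_apply (measurableSet_le (by fun_prop) (by fun_prop)),
    ← integral_toReal]
  · congr 1 with u
    rw [cdf_eq_real, measureReal_def]
    congr 2
    ext y
    have : 0 < 1 - p := by linarith
    simp only [Set.mem_preimage, Set.mem_ofPred_eq, Set.mem_Iic]
    rw [← mul_div_assoc, le_div_iff₀ this, ← le_sub_iff_add_le', div_mul_eq_mul_div,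
      div_le_iff₀ (by positivity), mul_comm (1 - p), mul_comm (x - p * u)]
  · exact (measurable_measure_prodMk_left
      (measurableSet_le (by fun_prop) (by fun_prop))).aemeasurable
  · exact ae_of_all _ fun u => measure_lt_top _ _

lemma hasDerivAt_outage_qCurve_zero {t m : ℕ} (ht : m + 2 ≤ t) {x : ℝ} (hx : 0 < x) :
    HasDerivAt (fun p => outage t x (qCurve t (m + 1) p))
      (((m + 1) * x) ^ m / (m.factorial : ℝ) * Real.exp (-((m + 1) * x)) *
        ((m + 1) * (x - 1))) 0 := by
  set g : ℝ := ((m + 1) * x) ^ m / (m.factorial : ℝ) * Real.exp (-((m + 1) * x)) with hg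
  have hint : Integrable (fun u => x - u) (expMeasure 1) :=
    (integrable_const x).sub integrable_id_expMeasure_one
  have hmeas (p : ℝ) : Measurable fun u : ℝ =>
      cdf (gammaMeasure (m + 1) 1) ((m + 1) * ((x - p * u) / (1 - p))) :=
    (monotone_cdf _).measurable.comp (by fun_prop)
  have key := (hasDerivAt_integral_of_dominated_loc_of_lip (μ := expMeasure 1)
    (F := fun p u => cdf (gammaMeasure (m + 1) 1) ((m + 1) * ((x - p * u) / (1 - p))))
    (F' := fun u => g * ((m + 1) * (x - u)))
    (bound := fun u => 4 * (m + 1) * |x - u|) (x₀ := (0 : ℝ)) (s := Metric.ball 0 (1 / 2))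
    (Metric.ball_mem_nhds _ (by norm_num))
    (Filter.Eventually.of_forall fun p => (hmeas p).aestronglyMeasurable)
    ?_ (by fun_prop) (ae_of_all _ fun u => ?_) (hint.abs.const_mul _)
    (ae_of_all _ fun u => ?_)).2
  · have hval : ∫ u, g * ((m + 1) * (x - u)) ∂(expMeasure 1) = g * ((m + 1) * (x - 1)) := by
      rw [integral_const_mul, integral_const_mul,
        integral_sub (integrable_const x) integrable_id_expMeasure_one,
        integral_id_expMeasure_one]
      simp
    rw [hval] at key
    refine key.congr_of_eventuallyEq ?_
    filter_upwards [gt_mem_nhds (zero_lt_one' ℝ)] with p hp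
    exact outage_qCurve_eq_integral_cdf ht x hp
  · refine Integrable.of_bound (hmeas 0).aestronglyMeasurable 1 (ae_of_all _ fun u => ?_)
    rw [Real.norm_of_nonneg (cdf_nonneg _ _)]
    exact cdf_le_one _ _
  · refine LipschitzOnWith.of_dist_le_mul fun p hp p' hp' => ?_
    rw [Real.dist_eq, Real.dist_eq, Real.coe_nnabs,
      abs_of_nonneg (a := 4 * (m + 1) * |x - u|) (by positivity)]
    refine (abs_cdf_gammaMeasure_sub_le _ _ _).trans ?_
    rw [mem_ball_zero_iff, Real.norm_eq_abs, abs_lt] at hp hp'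
    have h1 : 1 / 2 ≤ 1 - p := by linarith
    have h2 : 1 / 2 ≤ 1 - p' := by linarith
    have h1' : 0 < 1 - p := by linarith
    have h2' : 0 < 1 - p' := by linarith
    have e : (m + 1) * ((x - p * u) / (1 - p)) - (m + 1) * ((x - p' * u) / (1 - p')) =
        (m + 1) * ((x - u) * (p - p') / ((1 - p) * (1 - p'))) := by
      field_simp
      ring
    rw [e, abs_mul, abs_div, abs_mul, abs_of_pos (by positivity : (0 : ℝ) < m + 1),
      abs_of_pos (mul_pos h1' h2')]
    have h3 : |x - u| * |p - p'| / ((1 - p) * (1 - p')) ≤ |x - u| * |p - p'| * 4 := by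
      rw [div_le_iff₀ (mul_pos h1' h2')]
      have : 1 ≤ 4 * ((1 - p) * (1 - p')) := by nlinarith
      nlinarith [mul_nonneg (abs_nonneg (x - u)) (abs_nonneg (p - p'))]
    calc _ ≤ (m + 1) * (|x - u| * |p - p'| * 4) := by gcongr
      _ = _ := by ring
  · have hinner : HasDerivAt (fun p : ℝ => (m + 1) * ((x - p * u) / (1 - p)))
        ((m + 1) * (x - u)) 0 := by
      have h1 : HasDerivAt (fun p : ℝ => x - p * u) (-u) 0 := by
        simpa using ((hasDerivAt_id (0 : ℝ)).mul_const u).const_sub x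
      have h2 : HasDerivAt (fun p : ℝ => 1 - p) (-1) 0 := by
        simpa using (hasDerivAt_id (0 : ℝ)).const_sub 1
      convert! (h1.div h2 (by norm_num)).const_mul ((m : ℝ) + 1) using 1
      ring
    have houter := hasDerivAt_cdf_gammaMeasure m (y := (m + 1) * x) (by positivity)
    refine HasDerivAt.comp (0 : ℝ) (h₂ := cdf (gammaMeasure (m + 1) 1)) ?_ hinner
    simpa using houter

/-- A continuous density of `(1 / l) ∑ X_i` is determined on `(0, ∞)`. -/
lemma eq_of_map_sum_eq_withDensity {m : ℕ} {f : ℝ → ℝ} (hf : Continuous f)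
    (h : Measure.map (fun v : Fin (m + 2) → ℝ => (1 / ((m : ℝ) + 1)) * ∑ i, v i)
      (expLaw (m + 2)) = volume.withDensity fun y => ENNReal.ofReal (f y))
    {y : ℝ} (hy : 0 < y) :
    f y = (m + 1) * (((m + 1) * y) ^ (m + 1) / ((m + 1).factorial : ℝ) *
      Real.exp (-((m + 1) * y))) := by
  set d : ℝ → ℝ := fun y => (m + 1) * ((max ((m + 1) * y) 0) ^ (m + 1) /
    ((m + 1).factorial : ℝ) * Real.exp (-((m + 1) * y))) with hd
  have hdc : Continuous d := by fun_prop
  have hl : (0 : ℝ) < m + 1 := by positivity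
  have hdens (z : ℝ) :
      ENNReal.ofReal (d z) = ENNReal.ofReal (m + 1) *
        gammaPDF ((m + 1 : ℕ) + 1) 1 ((m + 1) * z) := by
    rw [gammaPDF, gammaPDFReal_nat_succ_one, ← ENNReal.ofReal_mul hl.le, hd]
    split_ifs with hz
    · simp only [max_eq_left hz]
    · simp [max_eq_right (not_le.1 hz).le]
  have hlaw : Measure.map (fun v : Fin (m + 2) → ℝ => (1 / ((m : ℝ) + 1)) * ∑ i, v i)
      (expLaw (m + 2)) = volume.withDensity fun y => ENNReal.ofReal (d y) := by
    have hsum := map_sum_expLaw (t := m + 2) (n := m + 1) (s := univ) (by simp)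
    have hcomp := Measure.map_map (μ := expLaw (m + 2)) (g := fun z : ℝ => (1 / ((m : ℝ) + 1)) * z)
      (f := fun v : Fin (m + 2) → ℝ => ∑ i, v i) (by fun_prop) (by fun_prop)
    rw [Function.comp_def] at hcomp
    rw [← hcomp, hsum]
    ext s hs
    have hm : Measurable (gammaPDF ((m + 1 : ℕ) + 1) 1) :=
      (measurable_gammaPDFReal _ 1).ennreal_ofReal
    have hscale := Real.map_volume_mul_left (a := 1 / ((m : ℝ) + 1)) (by positivity)
    rw [one_div, inv_inv, abs_of_pos hl] at hscale
    rw [Measure.map_apply (by fun_prop) hs, gammaMeasure,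
      withDensity_apply _ (hs.preimage (by fun_prop)), withDensity_apply _ hs]
    simp_rw [hdens]
    rw [lintegral_const_mul _ (by fun_prop), ← smul_eq_mul, ← lintegral_smul_measure,
      ← Measure.restrict_smul, ← hscale, setLIntegral_map hs (by fun_prop) (by fun_prop)]
    simp only [one_div]
    congr 1 with z
    field_simp
  rw [hlaw, withDensity_eq_iff_of_sigmaFinite (by fun_prop) (by fun_prop),
    Continuous.ae_eq_iff_eq (f := fun y => ENNReal.ofReal (d y))
      (g := fun y => ENNReal.ofReal (f y)) _ (ENNReal.continuous_ofReal.comp hdc)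
      (ENNReal.continuous_ofReal.comp hf)] at h
  have hyd : d y = (m + 1) * (((m + 1) * y) ^ (m + 1) / ((m + 1).factorial : ℝ) *
      Real.exp (-((m + 1) * y))) := by
    simp only [hd, max_eq_left (mul_pos hl hy).le]
  rw [← hyd]
  have hpos : 0 < d y := by rw [hyd]; positivity
  have hy' := congrFun h y
  have hfpos : 0 < f y := by
    rw [← ENNReal.ofReal_pos, ← hy', ENNReal.ofReal_pos]
    exact hpos
  exact ((ENNReal.ofReal_eq_ofReal_iff hpos.le hfpos.le).1 hy').symm

lemma deriv_eq_of_map_sum_eq_withDensity {m : ℕ} {f : ℝ → ℝ} (hf : Continuous f)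
    (h : Measure.map (fun v : Fin (m + 2) → ℝ => (1 / ((m : ℝ) + 1)) * ∑ i, v i)
      (expLaw (m + 2)) = volume.withDensity fun y => ENNReal.ofReal (f y))
    {x : ℝ} (hx : 0 < x) :
    deriv f x = (m + 1) ^ 2 * (((m + 1) * x) ^ m / (m.factorial : ℝ) *
      Real.exp (-((m + 1) * x))) * (1 - x) := by
  have heq : f =ᶠ[nhds x] fun y => (m + 1) * (((m + 1) * y) ^ (m + 1) /
      ((m + 1).factorial : ℝ) * Real.exp (-((m + 1) * y))) := by
    filter_upwards [lt_mem_nhds hx] with y hy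
    exact eq_of_map_sum_eq_withDensity hf h hy
  rw [heq.deriv_eq]
  have hlin : HasDerivAt (fun y : ℝ => (m + 1) * y) (m + 1) x := by
    simpa using (hasDerivAt_id x).const_mul ((m : ℝ) + 1)
  refine (((hlin.pow (m + 1)).div_const _).mul hlin.neg.exp |>.const_mul _).deriv.trans ?_
  have : (m.factorial : ℝ) ≠ 0 := by positivity
  simp only [Nat.factorial_succ, Nat.add_sub_cancel, Pi.pow_apply, Pi.neg_apply]
  push_cast
  field_simp
  ring

/-- The function `z ↦ ∫₀¹ sⁿ e^{-sz} ds`. -/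
noncomputable def truncLaplace (n : ℕ) (z : ℝ) : ℝ :=
  ∫ s in (0 : ℝ)..1, s ^ n * Real.exp (-(s * z))

lemma truncLaplace_zero_right (n : ℕ) : truncLaplace n 0 = 1 / (n + 1) := by
  simp [truncLaplace, integral_pow]

lemma hasDerivAt_truncLaplace (n : ℕ) (z : ℝ) :
    HasDerivAt (truncLaplace n) (-truncLaplace (n + 1) z) z := by
  have key := (intervalIntegral.hasDerivAt_integral_of_dominated_loc_of_deriv_le (μ := volume)
    (a := 0) (b := 1) (F := fun z s => s ^ n * Real.exp (-(s * z)))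
    (F' := fun z s => -(s ^ (n + 1) * Real.exp (-(s * z)))) (x₀ := z)
    (s := Metric.ball z 1) (bound := fun _ => Real.exp (|z| + 1))
    (Metric.ball_mem_nhds _ one_pos)
    (Filter.Eventually.of_forall fun _ => by fun_prop)
    (Continuous.intervalIntegrable (by fun_prop) _ _) (by fun_prop)
    (ae_of_all _ fun s hs w hw => ?_) (by simp) (ae_of_all _ fun s hs w hw => ?_)).2
  · rw [intervalIntegral.integral_neg] at key
    exact key
  · rw [Set.uIoc_of_le zero_le_one] at hs
    have hs0 := hs.1.le
    have hs1 := hs.2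
    rw [norm_neg, Real.norm_of_nonneg (by positivity)]
    have hw' : |w| ≤ |z| + 1 := by
      rw [Metric.mem_ball, Real.dist_eq] at hw
      have := abs_sub_abs_le_abs_sub w z
      linarith
    calc s ^ (n + 1) * Real.exp (-(s * w)) ≤ 1 * Real.exp (|z| + 1) := by
          gcongr
          · exact pow_le_one₀ hs0 hs1
          · nlinarith [neg_abs_le w, abs_nonneg w]
      _ = _ := one_mul _
  · have h : HasDerivAt (fun w => -(s * w)) (-s) w := by
      simpa using ((hasDerivAt_id w).const_mul s).fun_neg
    convert! h.exp.const_mul (s ^ n) using 1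
    ring

lemma mul_truncLaplace_succ (n : ℕ) (z : ℝ) :
    z * truncLaplace (n + 1) z = (n + 1) * truncLaplace n z - Real.exp (-z) := by
  have hd (s : ℝ) : HasDerivAt (fun s => s ^ (n + 1) * Real.exp (-(s * z)))
      ((n + 1) * (s ^ n * Real.exp (-(s * z))) - z * (s ^ (n + 1) * Real.exp (-(s * z)))) s := by
    have h : HasDerivAt (fun s => -(s * z)) (-z) s := by
      simpa using ((hasDerivAt_id s).mul_const z).fun_neg
    convert! (hasDerivAt_pow (n + 1) s).mul h.exp using 1
    push_cast
    ring
  have h := intervalIntegral.integral_eq_sub_of_hasDerivAt (a := 0) (b := 1)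
    (fun s _ => hd s) (Continuous.intervalIntegrable (by fun_prop) _ _)
  rw [intervalIntegral.integral_sub (Continuous.intervalIntegrable (by fun_prop) _ _)
    (Continuous.intervalIntegrable (by fun_prop) _ _), intervalIntegral.integral_const_mul,
    intervalIntegral.integral_const_mul] at h
  simp only [one_pow, one_mul, ne_eq, Nat.add_eq_zero_iff, one_ne_zero, and_false,
    not_false_eq_true, zero_pow, zero_mul, sub_zero] at h
  unfold truncLaplace
  linarith

lemma outage_qCurve_eq_integral_gamma {t m : ℕ} (ht : m + 2 ≤ t) (x : ℝ) {p : ℝ} (hp : 0 < p) :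
    outage t x (qCurve t (m + 1) p) =
      ∫ y, cdf (expMeasure 1) ((x - (1 - p) / (m + 1) * y) / p)
        ∂(gammaMeasure (m + 1) 1) := by
  rw [outage_qCurve ht, Measure.prod_apply_symm (measurableSet_le (by fun_prop) (by fun_prop)),
    ← integral_toReal]
  · congr 1 with y
    rw [cdf_eq_real, measureReal_def]
    congr 2
    ext u
    simp only [Set.mem_preimage, Set.mem_ofPred_eq, Set.mem_Iic]
    rw [le_div_iff₀ hp, le_sub_iff_add_le, mul_comm p]
  · exact (measurable_measure_prodMk_right
      (measurableSet_le (by fun_prop) (by fun_prop))).aemeasurable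
  · exact ae_of_all _ fun u => measure_lt_top _ _

lemma outage_qCurve_eq_truncLaplace {t m : ℕ} (ht : m + 2 ≤ t) {x p : ℝ} (hx : 0 < x)
    (hp : 0 < p) (hp1 : p < 1) :
    outage t x (qCurve t (m + 1) p) =
      ((m + 1) * x / (1 - p)) ^ (m + 1) / (m.factorial : ℝ) *
        (truncLaplace m ((m + 1) * x / (1 - p)) -
          Real.exp (-(x / p)) * truncLaplace m ((m + 1) * x / (1 - p) - x / p)) := by
  have hm : Measurable (gammaPDF (m + 1) 1) := (measurable_gammaPDFReal _ 1).ennreal_ofReal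
  have hq : 0 < 1 - p := by linarith
  set w := (m + 1) * x / (1 - p) with hw
  have hw0 : 0 < w := by positivity
  have hfac : (m.factorial : ℝ) ≠ 0 := by positivity
  rw [outage_qCurve_eq_integral_gamma ht x hp, gammaMeasure,
    integral_withDensity_eq_integral_toReal_smul hm
      (ae_of_all _ fun _ => ENNReal.ofReal_lt_top)]
  have hpt (y : ℝ) : (gammaPDF (m + 1) 1 y).toReal •
      cdf (expMeasure 1) ((x - (1 - p) / (m + 1) * y) / p) =
      (Set.Icc 0 w).indicator (fun y => y ^ m / (m.factorial : ℝ) * Real.exp (-y) *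
        (1 - Real.exp (-((x - (1 - p) / (m + 1) * y) / p)))) y := by
    rw [gammaPDF, ENNReal.toReal_ofReal (gammaPDFReal_nonneg (by positivity) one_pos y),
      gammaPDFReal_nat_succ_one, cdf_expMeasure_eq one_pos]
    have hiff : 0 ≤ (x - (1 - p) / (m + 1) * y) / p ↔ y ≤ w := by
      rw [le_div_iff₀ hp, zero_mul, sub_nonneg, hw, le_div_iff₀ hq, div_mul_eq_mul_div,
        div_le_iff₀ (by positivity), mul_comm (1 - p), mul_comm x]
    by_cases hy : 0 ≤ y
    · by_cases hyw : y ≤ w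
      · rw [Set.indicator_of_mem (Set.mem_Icc.2 ⟨hy, hyw⟩), if_pos hy, if_pos (hiff.2 hyw)]
        simp
      · rw [Set.indicator_of_notMem (fun h => hyw h.2), if_neg (fun h => hyw (hiff.1 h))]
        simp
    · rw [Set.indicator_of_notMem (fun h => hy h.1), if_neg hy]
      simp
  simp_rw [hpt]
  rw [integral_indicator measurableSet_Icc, integral_Icc_eq_integral_Ioc,
    ← intervalIntegral.integral_of_le hw0.le]
  have hsub := intervalIntegral.integral_comp_mul_left (a := 0) (b := 1)
    (fun y => y ^ m / (m.factorial : ℝ) * Real.exp (-y) *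
        (1 - Real.exp (-((x - (1 - p) / (m + 1) * y) / p)))) hw0.ne'
  rw [mul_zero, mul_one, smul_eq_mul, eq_inv_mul_iff_mul_eq₀ hw0.ne'] at hsub
  rw [← hsub, truncLaplace, truncLaplace, ← intervalIntegral.integral_const_mul,
    ← intervalIntegral.integral_const_mul,
    ← intervalIntegral.integral_sub (Continuous.intervalIntegrable (by fun_prop) _ _)
      (Continuous.intervalIntegrable (by fun_prop) _ _),
    ← intervalIntegral.integral_const_mul]
  congr 1 with s
  have e1 : Real.exp (-((x - (1 - p) / (m + 1) * (w * s)) / p)) =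
      Real.exp (-(x / p)) * Real.exp (s * (x / p)) := by
    rw [← Real.exp_add]
    congr 1
    rw [hw]
    field_simp
    ring
  have e2 : Real.exp (-(s * (w - x / p))) = Real.exp (-(w * s)) * Real.exp (s * (x / p)) := by
    rw [← Real.exp_add]
    congr 1
    ring
  rw [e1, e2, mul_comm s w, pow_succ, mul_pow]
  ring

/-- The derivative of the outage probability along `qCurve` at an interior point. -/
noncomputable def outageDeriv (m : ℕ) (x p : ℝ) : ℝ :=
  1 / (m.factorial : ℝ) * Real.exp (-(x / p)) * ((m + 1) * x / (1 - p)) ^ (m + 1) * (1 / p) *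
    ((m + 1) * x / (1 - p) / (m + 1) *
        truncLaplace (m + 1) ((m + 1) * x / (1 - p) - x / p) -
      x / p * (truncLaplace m ((m + 1) * x / (1 - p) - x / p) -
        truncLaplace (m + 1) ((m + 1) * x / (1 - p) - x / p)))

lemma hasDerivAt_div_one_sub (c : ℝ) {p : ℝ} (hp1 : p < 1) :
    HasDerivAt (fun p => c / (1 - p)) (c / (1 - p) ^ 2) p := by
  have h2 : HasDerivAt (fun p : ℝ => 1 - p) (-1) p := by
    simpa using (hasDerivAt_id p).const_sub 1
  convert! (hasDerivAt_const p c).div h2 (by linarith) using 1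
  ring

lemma hasDerivAt_const_div (c : ℝ) {p : ℝ} (hp : 0 < p) :
    HasDerivAt (fun p => c / p) (-(c / p ^ 2)) p := by
  convert! (hasDerivAt_const p c).div (hasDerivAt_id p) hp.ne' using 1
  simp only [id]
  ring

lemma hasDerivAt_outage_qCurve {t m : ℕ} (ht : m + 2 ≤ t) {x p : ℝ} (hx : 0 < x)
    (hp : 0 < p) (hp1 : p < 1) :
    HasDerivAt (fun p => outage t x (qCurve t (m + 1) p)) (outageDeriv m x p) p := by
  have hq : 0 < 1 - p := by linarith
  have hw := hasDerivAt_div_one_sub ((m + 1) * x) hp1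
  have hr := hasDerivAt_const_div x hp
  have hd := ((hw.pow (m + 1)).div_const (m.factorial : ℝ)).mul
    (((hasDerivAt_truncLaplace m _).comp p hw).sub
      (hr.neg.exp.mul ((hasDerivAt_truncLaplace m _).comp p (hw.sub hr))))
  refine (hd.congr_of_eventuallyEq ?_).congr_deriv ?_
  · filter_upwards [lt_mem_nhds hp, gt_mem_nhds hp1] with z hz hz1
    exact outage_qCurve_eq_truncLaplace ht hx hz hz1
  · have hfac : (m.factorial : ℝ) ≠ 0 := by positivity
    simp only [Function.comp_apply, Pi.pow_apply, Pi.neg_apply, Pi.mul_apply, Pi.sub_apply,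
      Nat.add_sub_cancel, outageDeriv]
    have h1 := mul_truncLaplace_succ m ((m + 1) * x / (1 - p))
    have h2 := mul_truncLaplace_succ m ((m + 1) * x / (1 - p) - x / p)
    have hexp : Real.exp (-((m + 1) * x / (1 - p))) =
        Real.exp (-(x / p)) * Real.exp (-((m + 1) * x / (1 - p) - x / p)) := by
      rw [← Real.exp_add]
      congr 1
      ring
    rw [hexp] at h1
    have hwd : (m + 1) * x / (1 - p) ^ 2 =
        ((m + 1) * x / (1 - p)) ^ 2 / ((m + 1) * x) := by
      field_simp
    have hrd : x / p ^ 2 = (x / p) ^ 2 / x := by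
      field_simp
    have hpr : 1 / p = (x / p) / x := by
      field_simp
    rw [hwd, hrd, hpr]
    generalize (m + 1) * x / (1 - p) = w at *
    generalize x / p = r at *
    generalize truncLaplace m w = A at *
    generalize truncLaplace (m + 1) w = A' at *
    generalize truncLaplace m (w - r) = B at *
    generalize truncLaplace (m + 1) (w - r) = B' at *
    have hE : Real.exp (-(w - r)) = (m + 1) * B - (w - r) * B' := by linarith
    rw [hE] at h1
    push_cast
    rw [pow_succ w m]
    field_simp
    linear_combination (-w ^ (m + 2)) * h1

lemma hasDerivAt_outageDeriv (m : ℕ) {x : ℝ} (hx : 0 < x) :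
    HasDerivAt (outageDeriv m x)
      (((m : ℝ) + 2) ^ (m + 4) / (((m : ℝ) + 1) ^ 2 * (m + 3) * m.factorial) *
        Real.exp (-((m + 2) * x)) * ((m + 3) - (m + 2) * x) * x ^ (m + 2)) (1 / (m + 2)) := by
  have hp : (0 : ℝ) < 1 / (m + 2) := by positivity
  have hp1 : (1 : ℝ) / (m + 2) < 1 := by
    rw [div_lt_one (by positivity)]
    have : (0 : ℝ) ≤ m := by positivity
    linarith
  have hw := hasDerivAt_div_one_sub ((m + 1) * x) hp1
  have hr := hasDerivAt_const_div x hp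
  have hpi := hasDerivAt_const_div 1 hp
  have h0 := (hasDerivAt_truncLaplace m _).comp _ (hw.sub hr)
  have h1 := (hasDerivAt_truncLaplace (m + 1) _).comp _ (hw.sub hr)
  have hd := (((hr.neg.exp.const_mul (1 / (m.factorial : ℝ))).mul (hw.pow (m + 1))).mul hpi).mul
    (((hw.div_const ((m : ℝ) + 1)).mul h1).sub (hr.mul (h0.sub h1)))
  refine hd.congr_deriv ?_
  have hfac : (m.factorial : ℝ) ≠ 0 := by positivity
  have h1p : (1 : ℝ) - 1 / (m + 2) = (m + 1) / (m + 2) := by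
    field_simp
    ring
  have hwv : (m + 1) * x / (1 - 1 / ((m : ℝ) + 2)) = (m + 2) * x := by
    rw [h1p]
    field_simp
  have hrv : x / (1 / ((m : ℝ) + 2)) = (m + 2) * x := by
    field_simp
  simp only [Function.comp_apply, Pi.pow_apply, Pi.neg_apply, Pi.mul_apply, Pi.sub_apply,
    Nat.add_sub_cancel, hwv, hrv, sub_self, truncLaplace_zero_right]
  rw [h1p, mul_pow, mul_pow]
  push_cast
  have : (m : ℝ) + 1 + 1 ≠ 0 := by positivity
  have : (m : ℝ) + 1 + 1 + 1 ≠ 0 := by positivity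
  field_simp
  ring

/-- fix `l ≥ 1` and `x > 0`. (i) The derivative of
`p ↦ P{⟨q(p),X⟩ ≤ x}` at `p = 0` equals `−(1/l)·f'_{(1/l)∑_{i=1}^{l+1} X_i}(x)`, which is
strictly negative iff `x < 1`. (ii) The second derivative at `p = 1/(l+1)` equals
`c(l)·e^{−(l+1)x}·(l+2−(l+1)x)·x^{l+1}` for some `c(l) > 0` depending only on `l`, hence is
strictly positive iff `x < (l+2)/(l+1)`. -/
theorem boundary_derivatives_of_outage (t l : ℕ) (hl : 1 ≤ l) (hlt : l + 1 ≤ t)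
    (f : ℝ → ℝ) (hf_cont : Continuous f)
    (hf_density :
      Measure.map (fun v : Fin (l + 1) → ℝ => (1 / (l : ℝ)) * ∑ i, v i) (expLaw (l + 1)) =
        MeasureTheory.volume.withDensity fun y => ENNReal.ofReal (f y)) :
    (∀ x : ℝ, 0 < x →
      HasDerivAt (fun p : ℝ => outage t x (qCurve t l p)) (-(1 / (l : ℝ)) * deriv f x) 0 ∧
      (-(1 / (l : ℝ)) * deriv f x < 0 ↔ x < 1)) ∧
    (∃ c : ℝ, 0 < c ∧ ∀ x : ℝ, 0 < x →
      iteratedDeriv 2 (fun p : ℝ => outage t x (qCurve t l p)) (1 / ((l : ℝ) + 1)) =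
          c * Real.exp (-((l : ℝ) + 1) * x) * (((l : ℝ) + 2) - ((l : ℝ) + 1) * x)
            * x ^ (l + 1) ∧
      (0 < iteratedDeriv 2 (fun p : ℝ => outage t x (qCurve t l p)) (1 / ((l : ℝ) + 1)) ↔
        x < ((l : ℝ) + 2) / ((l : ℝ) + 1))) := by
  obtain ⟨m, rfl⟩ : ∃ m, l = m + 1 := ⟨l - 1, by omega⟩
  have ht : m + 2 ≤ t := hlt
  push_cast at hf_density ⊢
  have hl0 : (0 : ℝ) < m + 1 := by positivity
  have hp0 : (1 : ℝ) / (m + 1 + 1) = 1 / (m + 2) := by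
    rw [add_assoc, one_add_one_eq_two]
  refine ⟨fun x hx => ?_, ?_⟩
  · set g : ℝ := ((m + 1) * x) ^ m / (m.factorial : ℝ) * Real.exp (-((m + 1) * x)) with hg
    have hgpos : 0 < g := by positivity
    have hval : -(1 / ((m : ℝ) + 1)) * deriv f x = g * ((m + 1) * (x - 1)) := by
      rw [deriv_eq_of_map_sum_eq_withDensity hf_cont hf_density hx, ← hg]
      field_simp
      ring
    rw [hval]
    refine ⟨hasDerivAt_outage_qCurve_zero ht hx, ?_⟩
    rw [← sub_neg (a := x), ← mul_assoc, ← smul_eq_mul, smul_neg_iff_of_pos_left (by positivity)]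
  · set c : ℝ := ((m : ℝ) + 2) ^ (m + 4) / (((m : ℝ) + 1) ^ 2 * (m + 3) * m.factorial) with hc
    have hcpos : 0 < c := by positivity
    refine ⟨c, hcpos, fun x hx => ?_⟩
    have hval : iteratedDeriv 2 (fun p : ℝ => outage t x (qCurve t (m + 1) p))
        (1 / ((m : ℝ) + 1 + 1)) =
        c * Real.exp (-((m : ℝ) + 1 + 1) * x) * (((m : ℝ) + 1 + 2) - ((m : ℝ) + 1 + 1) * x)
          * x ^ (m + 1 + 1) := by
      have hpos : (0 : ℝ) < 1 / (m + 2) := by positivity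
      have hlt1 : (1 : ℝ) / (m + 2) < 1 := by
        rw [div_lt_one (by positivity)]
        linarith
      have heq : deriv (fun p : ℝ => outage t x (qCurve t (m + 1) p)) =ᶠ[nhds (1 / ((m : ℝ) + 2))]
          outageDeriv m x := by
        filter_upwards [lt_mem_nhds hpos, gt_mem_nhds hlt1] with p hp hp1
        exact (hasDerivAt_outage_qCurve ht hx hp hp1).deriv
      rw [iteratedDeriv_succ, iteratedDeriv_one, hp0, heq.deriv_eq,
        (hasDerivAt_outageDeriv m hx).deriv, ← hc]
      ring_nf
    refine ⟨hval, ?_⟩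
    rw [hval, mul_pos_iff_of_pos_right (by positivity), mul_pos_iff_of_pos_left (by positivity),
      sub_pos, lt_div_iff₀ (by positivity), mul_comm x]
end
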